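/- Let N ≥ 2, m ≥ 1 with m < N, 1 < p < ∞, and α ∈ [1, p). Then there exists a constant C > 0 such that for every f ∈ C_c^∞(ℝ^N) there exists a family of polynomials P_{x,t,f} of degree at most m−1, indexed by x ∈ ℝ^N and 0 < t < 1 and depending continuously on (x,t,y), such that ∫_{ℝ^N} [ sup_{0<t<1} ⨍_{B(x,t)} ( t^{−m} |f(y) − P_{x,t,f}(y)| )^α dy ]^{p/α} dx ≤ C ‖f‖_{h^{m,p}}^p. -/

import Mathlib

open MeasureTheory Set Metric Filter
open scoped ENNReal NNReal Topology

noncomputable section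

abbrev RN (N : ℕ) := EuclideanSpace ℝ (Fin N)

variable {N : ℕ}

/-- Partial derivative in the `i`-th coordinate direction. -/
def pd {E : Type*} [NormedAddCommGroup E] [NormedSpace ℝ E] (i : Fin N)
    (f : RN N → E) : RN N → E :=
  fun x => fderiv ℝ f x (EuclideanSpace.single i 1)

/-- Multi-index partial derivative `∂^α`. -/
def md {E : Type*} [NormedAddCommGroup E] [NormedSpace ℝ E] (α : Fin N → ℕ)
    (f : RN N → E) : RN N → E :=
  ((List.ofFn fun i : Fin N => (pd i)^[α i]).foldr (· ∘ ·) id) f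

/-- Order `|α|` of a multi-index. -/
def mOrder (α : Fin N → ℕ) : ℕ := ∑ i, α i

/-- Multi-indices of order at most `k`. -/
def idxLe (N k : ℕ) : Finset (Fin N → ℕ) :=
  (Fintype.piFinset fun _ : Fin N => Finset.range (k + 1)).filter fun α => mOrder α ≤ k

/-- Multi-indices of order exactly `k`. -/
def idxEq (N k : ℕ) : Finset (Fin N → ℕ) :=
  (Fintype.piFinset fun _ : Fin N => Finset.range (k + 1)).filter fun α => mOrder α = k

/-- The dilate `φ_t(z) = t^{-N} φ(z/t)`. -/
def dil (φ : RN N → ℝ) (t : ℝ) (z : RN N) : ℝ := φ (t⁻¹ • z) / t ^ N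

/-- Convolution `(u * φ_t)(x)`. -/
def convAt (φ : RN N → ℝ) (t : ℝ) (u : RN N → ℂ) (x : RN N) : ℂ :=
  ∫ y, dil φ t (x - y) • u y

/-- The small maximal function `sup_{0<t<1} |(u * φ_t)(x)|`. -/
def smallMax (φ : RN N → ℝ) (u : RN N → ℂ) (x : RN N) : ℝ≥0∞ :=
  ⨆ t ∈ Ioo (0 : ℝ) 1, ENNReal.ofReal ‖convAt φ t u x‖

/-- The localizable Hardy space quasi-norm `‖u‖_{h^p}` (for `0 < p < ∞`). -/
def hNorm (φ : RN N → ℝ) (p : ℝ) (u : RN N → ℂ) : ℝ≥0∞ :=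
  (∫⁻ x, smallMax φ u x ^ p) ^ (1 / p)

/-- A fixed radial nonnegative smooth function supported in the unit ball with integral 1. -/
structure GoodPhi (φ : RN N → ℝ) : Prop where
  smooth : ContDiff ℝ (⊤ : ℕ∞) φ
  nonneg : ∀ x, 0 ≤ φ x
  radial : ∀ x y : RN N, ‖x‖ = ‖y‖ → φ x = φ y
  supp : tsupport φ ⊆ closedBall 0 1
  int_one : ∫ x, φ x = 1

/-- The closed axes-parallel cube with center `c` and side length `ℓ`. -/
def cube (c : RN N) (ℓ : ℝ) : Set (RN N) := {y | ∀ i, |y i - c i| ≤ ℓ / 2}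

/-- The open axes-parallel cube with center `c` and side length `ℓ`
(the interior of `cube c ℓ` when `ℓ > 0`). -/
def openCube (c : RN N) (ℓ : ℝ) : Set (RN N) := {y | ∀ i, |y i - c i| < ℓ / 2}

/-- `P` is a (complex) polynomial in `N` variables of degree at most `d`. -/
def IsPolyDegLE (N d : ℕ) (P : RN N → ℂ) : Prop :=
  ∃ c : (Fin N → ℕ) → ℂ, ∀ x : RN N, P x = ∑ α ∈ idxLe N d, c α * ∏ i, ((x i : ℝ) : ℂ) ^ α i

/-- The centred Hardy-Littlewood maximal function with radii less than `1`. -/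
def localMaximal (u : RN N → ℝ≥0∞) (x : RN N) : ℝ≥0∞ :=
  ⨆ t ∈ Ioo (0 : ℝ) 1, (∫⁻ y in ball x t, u y) / volume (ball x t)

lemma volume_ball_RN (x : RN N) {t : ℝ} (ht : 0 < t) :
    volume (ball x t) = ENNReal.ofReal (t ^ N) * volume (ball (0 : RN N) 1) := by
  simpa using Measure.addHaar_ball_of_pos volume x ht

lemma lowerSemicontinuous_lintegral_ball (u : RN N → ℝ≥0∞) (t : ℝ) :
    LowerSemicontinuous fun x : RN N => ∫⁻ y in ball x t, u y := by
  intro x l hl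
  have hU : ball x t = ⋃ n : ℕ, ball x (t - 1 / ((n : ℝ) + 1)) := by
    ext y
    simp only [mem_ball, mem_iUnion]
    constructor
    · intro h
      obtain ⟨n, hn⟩ := exists_nat_one_div_lt (sub_pos.2 h)
      exact ⟨n, by linarith⟩
    · rintro ⟨n, hn⟩
      have : (0 : ℝ) < 1 / ((n : ℝ) + 1) := by positivity
      linarith
  have hmono : Monotone fun n : ℕ => ball x (t - 1 / ((n : ℝ) + 1)) := by
    intro a b hab
    apply ball_subset_ball
    have := Nat.one_div_le_one_div (α := ℝ) hab
    linarith
  change l < ∫⁻ y in ball x t, u y at hl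
  rw [hU, setLIntegral_iUnion_of_directed _ (directed_of_isDirected_le hmono)] at hl
  obtain ⟨n, hn⟩ := lt_iSup_iff.1 hl
  have hpos : (0 : ℝ) < 1 / ((n : ℝ) + 1) := by positivity
  filter_upwards [ball_mem_nhds x hpos] with x' hx'
  refine hn.trans_le (lintegral_mono_set ?_)
  apply ball_subset_ball'
  rw [mem_ball, dist_comm] at hx'
  linarith

lemma measurable_localMaximal (u : RN N → ℝ≥0∞) : Measurable (localMaximal u) := by
  have h : LowerSemicontinuous (localMaximal u) := by
    refine lowerSemicontinuous_biSup fun t ht => ?_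
    have hc : (fun x : RN N => (∫⁻ y in ball x t, u y) / volume (ball x t)) =
        fun x : RN N => (∫⁻ y in ball x t, u y) / volume (ball (0 : RN N) t) := by
      funext x
      rw [volume_ball_RN x ht.1, volume_ball_RN 0 ht.1]
    rw [hc]
    intro x l hl
    have hl' : l * volume (ball (0 : RN N) t) < ∫⁻ y in ball x t, u y := by
      change l < _ / _ at hl
      rwa [ENNReal.lt_div_iff_mul_lt (Or.inl (measure_ball_pos _ _ ht.1).ne')
        (Or.inl measure_ball_lt_top.ne)] at hl
    filter_upwards [lowerSemicontinuous_lintegral_ball u t x _ hl'] with y hy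
    change l < _ / _
    rwa [ENNReal.lt_div_iff_mul_lt (Or.inl (measure_ball_pos _ _ ht.1).ne')
        (Or.inl measure_ball_lt_top.ne)]
  exact h.measurable

/-- The weak type (1,1) bound for the local maximal function. -/
lemma mul_volume_lt_localMaximal_le (u : RN N → ℝ≥0∞) (l : ℝ≥0∞) :
    l * volume {x | l < localMaximal u x} ≤ 5 ^ N * ∫⁻ y, u y := by
  set S := {x | l < localMaximal u x} with hS
  have hex : ∀ x ∈ S, ∃ t ∈ Ioo (0 : ℝ) 1, l * volume (ball x t) ≤ ∫⁻ y in ball x t, u y := by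
    intro x hx
    simp only [hS, localMaximal, mem_ofPred_eq, lt_iSup_iff] at hx
    obtain ⟨t, ht, h⟩ := hx
    refine ⟨t, ht, ?_⟩
    rw [ENNReal.lt_div_iff_mul_lt (Or.inl (measure_ball_pos _ _ ht.1).ne')
        (Or.inl measure_ball_lt_top.ne)] at h
    exact h.le
  choose! r hr hint using hex
  obtain ⟨v, hvS, hdis, hcov⟩ := Vitali.exists_disjoint_subfamily_covering_enlargement_closedBall
    S (id : RN N → RN N) r 1 (fun a ha => (hr a ha).2.le) 5 (by norm_num)
  have hdis' : v.PairwiseDisjoint fun a => ball a (r a) :=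
    hdis.mono_on fun a _ => ball_subset_closedBall
  have hvc : v.Countable := hdis'.countable_of_isOpen (fun a _ => isOpen_ball)
    fun a ha => nonempty_ball.2 (hr a (hvS ha)).1
  have hsub : S ⊆ ⋃ b ∈ v, closedBall b (5 * r b) := by
    intro a ha
    obtain ⟨b, hb, hab⟩ := hcov a ha
    exact mem_biUnion hb (hab (mem_closedBall_self (hr a ha).1.le))
  have : Countable v := hvc.to_subtype
  calc l * volume S ≤ l * ∑' b : v, volume (closedBall (b : RN N) (5 * r b)) := by
        gcongr
        exact (measure_mono hsub).trans (measure_biUnion_le _ hvc _)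
    _ = ∑' b : v, 5 ^ N * (l * volume (ball (b : RN N) (r b))) := by
        rw [← ENNReal.tsum_mul_left]
        congr 1
        funext b
        have hb := (hr b (hvS b.2)).1
        rw [Measure.addHaar_closedBall _ _ (by positivity), volume_ball_RN _ hb,
          finrank_euclideanSpace, Fintype.card_fin, mul_pow, ENNReal.ofReal_mul (by positivity)]
        have : ENNReal.ofReal ((5 : ℝ) ^ N) = 5 ^ N := by
          rw [ENNReal.ofReal_pow (by norm_num)]; norm_num
        rw [this]
        ring
    _ ≤ ∑' b : v, 5 ^ N * ∫⁻ y in ball (b : RN N) (r b), u y := by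
        gcongr with b
        exact hint b (hvS b.2)
    _ = 5 ^ N * ∫⁻ y in ⋃ b ∈ v, ball b (r b), u y := by
        rw [ENNReal.tsum_mul_left, lintegral_biUnion hvc (fun _ _ => measurableSet_ball) hdis']
    _ ≤ 5 ^ N * ∫⁻ y, u y := by
        gcongr
        exact Measure.restrict_le_self

lemma localMaximal_ofReal_le {w : RN N → ℝ} {K : ℝ} (hK : ∀ x, w x ≤ K) (x : RN N) :
    localMaximal (fun y => ENNReal.ofReal (w y)) x ≤ ENNReal.ofReal K := by
  refine iSup₂_le fun t ht => ENNReal.div_le_of_le_mul ?_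
  calc ∫⁻ y in ball x t, ENNReal.ofReal (w y) ≤ ∫⁻ _ in ball x t, ENNReal.ofReal K :=
        lintegral_mono fun y => ENNReal.ofReal_le_ofReal (hK y)
    _ = _ := by simp

/-- The weak type bound obtained by truncating the function at height `l`. -/
lemma mul_volume_two_mul_lt_localMaximal_le {w : RN N → ℝ} (hw : Measurable w) {l : ℝ}
    (hl : 0 ≤ l) :
    ENNReal.ofReal l *
        volume {x | ENNReal.ofReal (2 * l) < localMaximal (fun y => ENNReal.ofReal (w y)) x} ≤
      5 ^ N * ∫⁻ y in {y | l < w y}, ENNReal.ofReal (w y) := by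
  have hm : MeasurableSet {y | l < w y} := measurableSet_lt measurable_const hw
  rw [← lintegral_indicator hm]
  refine le_trans ?_ (mul_volume_lt_localMaximal_le _ (ENNReal.ofReal l))
  gcongr _ * volume ?_
  intro x hx
  simp only [mem_ofPred_eq] at hx ⊢
  have hle : localMaximal (fun y => ENNReal.ofReal (w y)) x ≤
      localMaximal ({y | l < w y}.indicator fun y => ENNReal.ofReal (w y)) x +
        ENNReal.ofReal l := by
    refine iSup₂_le fun t ht => ?_
    have h0 : (∫⁻ y in ball x t, ({y | l < w y}.indicator fun y => ENNReal.ofReal (w y)) y) /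
        volume (ball x t) ≤ _ := le_iSup₂ (f := fun t (_ : t ∈ Ioo (0 : ℝ) 1) =>
          (∫⁻ y in ball x t, ({y | l < w y}.indicator fun y => ENNReal.ofReal (w y)) y) /
        volume (ball x t)) t ht
    refine le_trans ?_ (add_le_add_left h0 _)
    refine ENNReal.div_le_of_le_mul ?_
    rw [add_mul, ENNReal.div_mul_cancel (measure_ball_pos _ _ ht.1).ne' measure_ball_lt_top.ne]
    calc ∫⁻ y in ball x t, ENNReal.ofReal (w y)
        ≤ ∫⁻ y in ball x t, (({y | l < w y}.indicator fun y => ENNReal.ofReal (w y)) y +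
            ENNReal.ofReal l) := by
          refine lintegral_mono fun y => ?_
          by_cases hy : l < w y
          · simp [indicator, hy]
          · simpa [indicator, hy] using ENNReal.ofReal_le_ofReal (not_lt.1 hy)
      _ = _ := by
          rw [lintegral_add_right _ measurable_const]
          simp
  by_contra! hcon
  have := hx.trans_le (hle.trans (add_le_add_left hcon _))
  rw [← ENNReal.ofReal_add hl hl, two_mul] at this
  exact lt_irrefl _ this

/-- The strong type `(q,q)` bound for the local maximal function of a bounded function. -/
lemma lintegral_localMaximal_rpow_le {q : ℝ} (hq : 1 < q) {w : RN N → ℝ} (hw : Measurable w)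
    (hw0 : ∀ x, 0 ≤ w x) {K : ℝ} (hK : ∀ x, w x ≤ K) :
    ∫⁻ x, localMaximal (fun y => ENNReal.ofReal (w y)) x ^ q ≤
      ENNReal.ofReal (2 ^ q * q * 5 ^ N / (q - 1)) * ∫⁻ x, ENNReal.ofReal (w x ^ q) := by
  set M := localMaximal (fun y => ENNReal.ofReal (w y)) with hM
  have hfin : ∀ x, M x ≠ ∞ := fun x =>
    ((localMaximal_ofReal_le hK x).trans_lt ENNReal.ofReal_lt_top).ne
  have hMm : Measurable M := measurable_localMaximal _
  have hwm : Measurable fun y => ENNReal.ofReal (w y) := hw.ennreal_ofReal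
  have hq0 : 0 < q := by linarith
  set ν : Measure (RN N) := volume.withDensity fun y => ENNReal.ofReal (w y) with hν
  have h1 : ∀ x, M x ^ q = ENNReal.ofReal (2 ^ q) * ENNReal.ofReal (((M x).toReal / 2) ^ q) := by
    intro x
    have h0 : 0 ≤ (M x).toReal := ENNReal.toReal_nonneg
    rw [← ENNReal.ofReal_mul (by positivity), ← Real.mul_rpow (by norm_num) (by positivity),
      mul_div_cancel₀ _ (by norm_num), ← ENNReal.ofReal_rpow_of_nonneg h0 hq0.le,
      ENNReal.ofReal_toReal (hfin x)]
  have h2 := lintegral_rpow_eq_lintegral_meas_lt_mul (μ := (volume : Measure (RN N)))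
    (f := fun x => (M x).toReal / 2)
    (Filter.Eventually.of_forall fun x => by
      have : 0 ≤ (M x).toReal := ENNReal.toReal_nonneg
      simpa using by positivity)
    (hMm.ennreal_toReal.div_const 2).aemeasurable hq0
  have h3 := lintegral_rpow_eq_lintegral_meas_lt_mul (μ := ν) (f := w)
    (Filter.Eventually.of_forall hw0) hw.aemeasurable (p := q - 1) (by linarith)
  have h4 : ∫⁻ x, ENNReal.ofReal (w x ^ (q - 1)) ∂ν = ∫⁻ x, ENNReal.ofReal (w x ^ q) := by
    rw [hν, lintegral_withDensity_eq_lintegral_mul _ hwm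
      (hw.pow_const _).ennreal_ofReal]
    refine lintegral_congr fun x => ?_
    rw [Pi.mul_apply, ← ENNReal.ofReal_mul (hw0 x)]
    congr 1
    conv_lhs => rw [← Real.rpow_one (w x), ← Real.rpow_mul (hw0 x), one_mul]
    rw [← Real.rpow_add' (hw0 x) (by linarith)]
    congr 1
    ring
  have h5 : ∫⁻ t in Ioi (0 : ℝ), volume {x | t < (M x).toReal / 2} * ENNReal.ofReal (t ^ (q - 1)) ≤
      5 ^ N * ∫⁻ t in Ioi (0 : ℝ), ν {x | t < w x} * ENNReal.ofReal (t ^ (q - 1 - 1)) := by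
    rw [← lintegral_const_mul' _ _ (by finiteness)]
    refine setLIntegral_mono' measurableSet_Ioi fun t ht => ?_
    have ht0 : (0 : ℝ) < t := ht
    have hset : {x | t < (M x).toReal / 2} = {x | ENNReal.ofReal (2 * t) < M x} := by
      ext x
      simp only [mem_ofPred_eq]
      rw [ENNReal.ofReal_lt_iff_lt_toReal (by positivity) (hfin x), lt_div_iff₀' (by norm_num)]
    have htq : t ^ (q - 1) = t * t ^ (q - 1 - 1) := by
      rw [Real.rpow_sub_one ht0.ne' (q - 1), mul_div_cancel₀ _ ht0.ne']
    rw [hset, htq, ENNReal.ofReal_mul ht0.le, ← mul_assoc, ← mul_assoc]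
    refine mul_le_mul_left ?_ _
    rw [mul_comm, hν, withDensity_apply _ (measurableSet_lt measurable_const hw)]
    exact mul_volume_two_mul_lt_localMaximal_le hw ht0.le
  have h6 : ∫⁻ t in Ioi (0 : ℝ), ν {x | t < w x} * ENNReal.ofReal (t ^ (q - 1 - 1)) =
      ENNReal.ofReal (1 / (q - 1)) * ∫⁻ x, ENNReal.ofReal (w x ^ q) := by
    rw [← h4, h3, ← mul_assoc, ← ENNReal.ofReal_mul (by
      have : 0 < q - 1 := by linarith
      positivity), one_div_mul_cancel (by linarith), ENNReal.ofReal_one, one_mul]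
  calc ∫⁻ x, M x ^ q = ENNReal.ofReal (2 ^ q) * (ENNReal.ofReal q * ∫⁻ t in Ioi (0 : ℝ),
        volume {x | t < (M x).toReal / 2} * ENNReal.ofReal (t ^ (q - 1))) := by
        rw [← h2, ← lintegral_const_mul' _ _ (by finiteness)]
        exact lintegral_congr h1
    _ ≤ ENNReal.ofReal (2 ^ q) * (ENNReal.ofReal q * (5 ^ N * (ENNReal.ofReal (1 / (q - 1)) *
          ∫⁻ x, ENNReal.ofReal (w x ^ q)))) := by
        rw [← h6]
        gcongr
    _ = _ := by
        have h55 : (5 : ℝ≥0∞) ^ N = ENNReal.ofReal (5 ^ N) := by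
          rw [ENNReal.ofReal_pow (by norm_num)]; norm_num
        rw [h55, ← mul_assoc, ← mul_assoc, ← mul_assoc, ← ENNReal.ofReal_mul (by positivity),
          ← ENNReal.ofReal_mul (by positivity), ← ENNReal.ofReal_mul (by positivity)]
        congr 2
        ring

lemma ContDiff.pd {f : RN N → ℂ} (hf : ContDiff ℝ (⊤ : ℕ∞) f) (i : Fin N) :
    ContDiff ℝ (⊤ : ℕ∞) (pd i f) :=
  (hf.fderiv_right (m := (⊤ : ℕ∞)) le_rfl).clm_apply contDiff_const

lemma pd_comm {f : RN N → ℂ} (hf : ContDiff ℝ (⊤ : ℕ∞) f) (i j : Fin N) :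
    pd i (pd j f) = pd j (pd i f) := by
  have key : ∀ (i j : Fin N) (x : RN N), pd i (pd j f) x =
      fderiv ℝ (fderiv ℝ f) x (EuclideanSpace.single i 1) (EuclideanSpace.single j 1) := by
    intro i j x
    have hd : DifferentiableAt ℝ (fderiv ℝ f) x :=
      ((hf.fderiv_right (m := (⊤ : ℕ∞)) le_rfl).differentiable (by simp)) x
    change fderiv ℝ (fun y => fderiv ℝ f y (EuclideanSpace.single j 1)) x _ = _
    rw [fderiv_clm_apply hd (differentiableAt_const _)]
    simp
  funext x
  rw [key, key]
  exact (hf.contDiffAt.isSymmSndFDerivAt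
    (by rw [minSmoothness_of_isRCLikeNormedField]; exact WithTop.coe_le_coe.2 le_top)) _ _

lemma ContDiff.pd_iterate {f : RN N → ℂ} (hf : ContDiff ℝ (⊤ : ℕ∞) f) (i : Fin N) (n : ℕ) :
    ContDiff ℝ (⊤ : ℕ∞) ((_root_.pd i)^[n] f) := by
  induction n with
  | zero => exact hf
  | succ n ih => rw [Function.iterate_succ_apply']; exact ih.pd i

lemma pd_pd_iterate {f : RN N → ℂ} (hf : ContDiff ℝ (⊤ : ℕ∞) f) (i j : Fin N) (n : ℕ) :
    pd i ((pd j)^[n] f) = (pd j)^[n] (pd i f) := by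
  induction n with
  | zero => rfl
  | succ n ih =>
    rw [Function.iterate_succ_apply', Function.iterate_succ_apply', pd_comm (hf.pd_iterate j n), ih]

lemma ContDiff.foldr_pd {f : RN N → ℂ} (hf : ContDiff ℝ (⊤ : ℕ∞) f) (γ : Fin N → ℕ)
    (l : List (Fin N)) :
    ContDiff ℝ (⊤ : ℕ∞) ((l.map fun i => (_root_.pd i)^[γ i]).foldr (· ∘ ·) id f) := by
  induction l with
  | nil => exact hf
  | cons a l ih => exact ih.pd_iterate a _

lemma ContDiff.md {f : RN N → ℂ} (hf : ContDiff ℝ (⊤ : ℕ∞) f) (γ : Fin N → ℕ) :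
    ContDiff ℝ (⊤ : ℕ∞) (md γ f) := by
  rw [_root_.md, List.ofFn_eq_map]
  exact hf.foldr_pd γ _

lemma pd_foldr {f : RN N → ℂ} (hf : ContDiff ℝ (⊤ : ℕ∞) f) (γ : Fin N → ℕ) (i : Fin N)
    {l : List (Fin N)} (hl : l.Nodup) (hi : i ∈ l) :
    pd i ((l.map fun j => (pd (E := ℂ) j)^[γ j]).foldr (· ∘ ·) id f) =
      (l.map fun j => (pd j)^[(γ + Pi.single i 1 : Fin N → ℕ) j]).foldr (· ∘ ·) id f := by
  induction l with
  | nil => simp at hi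
  | cons a l ih =>
    simp only [List.map_cons, List.foldr_cons, Function.comp_apply]
    rw [List.nodup_cons] at hl
    by_cases hia : i = a
    · subst hia
      have hrest : (l.map fun j => (pd (E := ℂ) j)^[(γ + Pi.single i 1 : Fin N → ℕ) j]) =
          l.map fun j => (pd j)^[γ j] := by
        refine List.map_congr_left fun j hj => ?_
        have : j ≠ i := fun h => hl.1 (h ▸ hj)
        simp [this]
      rw [hrest, Pi.add_apply, Pi.single_eq_same, Function.iterate_succ_apply']
    · rw [pd_pd_iterate (hf.foldr_pd γ l), ih hl.2 ((List.mem_cons.1 hi).resolve_left hia)]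
      have : a ≠ i := Ne.symm hia
      simp [this]

lemma pd_md {f : RN N → ℂ} (hf : ContDiff ℝ (⊤ : ℕ∞) f) (γ : Fin N → ℕ) (i : Fin N) :
    pd i (md γ f) = md (γ + Pi.single i 1) f := by
  rw [md, md, List.ofFn_eq_map, List.ofFn_eq_map]
  exact pd_foldr hf γ i (List.nodup_finRange N) (List.mem_finRange i)

lemma md_zero (f : RN N → ℂ) : md 0 f = f := by
  have : ∀ l : List (Fin N), (l.map fun i => (pd (E := ℂ) i)^[(0 : Fin N → ℕ) i]).foldr
      (· ∘ ·) id f = f := by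
    intro l
    induction l with
    | nil => rfl
    | cons a l ih => exact ih
  rw [md, List.ofFn_eq_map]
  exact this _

/-- The sum of the norms of all partial derivatives of order `k`. -/
def derivSum : ℕ → (RN N → ℂ) → RN N → ℝ
  | 0, f, x => ‖f x‖
  | k + 1, f, x => ∑ i, derivSum k (pd i f) x

lemma derivSum_nonneg (k : ℕ) (f : RN N → ℂ) (x : RN N) : 0 ≤ derivSum k f x := by
  induction k generalizing f with
  | zero => exact norm_nonneg _
  | succ k ih => exact Finset.sum_nonneg fun i _ => ih _

lemma continuous_derivSum (k : ℕ) {f : RN N → ℂ} (hf : ContDiff ℝ (⊤ : ℕ∞) f) :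
    Continuous (derivSum k f) := by
  induction k generalizing f with
  | zero => exact hf.continuous.norm
  | succ k ih => exact continuous_finsetSum _ fun i _ => ih (hf.pd i)

lemma HasCompactSupport.pd {f : RN N → ℂ} (hf : HasCompactSupport f) (i : Fin N) :
    HasCompactSupport (pd i f) :=
  (hf.fderiv (𝕜 := ℝ)).comp_left (g := fun L : RN N →L[ℝ] ℂ => L (EuclideanSpace.single i 1)) rfl

lemma exists_derivSum_le (k : ℕ) {f : RN N → ℂ} (hf : ContDiff ℝ (⊤ : ℕ∞) f)
    (hc : HasCompactSupport f) : ∃ K, ∀ x, derivSum k f x ≤ K := by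
  induction k generalizing f with
  | zero => exact hf.continuous.bounded_above_of_compact_support hc
  | succ k ih =>
    choose K hK using fun i => ih (hf.pd i) (hc.pd i)
    exact ⟨∑ i, K i, fun x => Finset.sum_le_sum fun i _ => hK i x⟩

lemma mem_idxLe {k : ℕ} {γ : Fin N → ℕ} : γ ∈ idxLe N k ↔ mOrder γ ≤ k := by
  simp only [idxLe, Finset.mem_filter, Fintype.mem_piFinset, Finset.mem_range,
    Nat.lt_succ_iff, and_iff_right_iff_imp]
  exact fun h i => (Finset.single_le_sum (f := γ) (fun _ _ => Nat.zero_le _)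
    (Finset.mem_univ i)).trans h

lemma derivSum_md_le {f : RN N → ℂ} (hf : ContDiff ℝ (⊤ : ℕ∞) f) {m : ℕ} (k : ℕ)
    (γ : Fin N → ℕ) (h : mOrder γ + k ≤ m) (x : RN N) :
    derivSum k (md γ f) x ≤ (N : ℝ) ^ k * ∑ β ∈ idxLe N m, ‖md β f x‖ := by
  induction k generalizing γ with
  | zero =>
    rw [pow_zero, one_mul]
    exact Finset.single_le_sum (f := fun β => ‖md β f x‖) (fun _ _ => norm_nonneg _)
      (mem_idxLe.2 (by omega))
  | succ k ih =>
    calc derivSum (k + 1) (md γ f) x = ∑ i, derivSum k (md (γ + Pi.single i 1) f) x :=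
          Finset.sum_congr rfl fun i _ => by rw [pd_md hf]
      _ ≤ ∑ _i : Fin N, (N : ℝ) ^ k * ∑ β ∈ idxLe N m, ‖md β f x‖ := by
          refine Finset.sum_le_sum fun i _ => ih _ ?_
          have : mOrder (γ + Pi.single i 1) = mOrder γ + 1 := by
            simp [mOrder, Finset.sum_add_distrib]
          omega
      _ = _ := by simp [pow_succ]; ring

/-- The `k`-th iterated derivative of `f` at `x` in the direction `v`. -/
def dirDeriv : ℕ → (RN N → ℂ) → RN N → RN N → ℂ
  | 0, f, x, _ => f x
  | k + 1, f, x, v => ∑ i, (v i : ℂ) * dirDeriv k (pd i f) x v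

lemma continuous_dirDeriv (k : ℕ) {f : RN N → ℂ} (hf : ContDiff ℝ (⊤ : ℕ∞) f) :
    Continuous fun z : RN N × RN N => dirDeriv k f z.1 z.2 := by
  induction k generalizing f with
  | zero => exact hf.continuous.comp continuous_fst
  | succ k ih =>
    refine continuous_finsetSum _ fun i _ => Continuous.mul ?_ (ih (hf.pd i))
    fun_prop

lemma norm_dirDeriv_le (k : ℕ) (f : RN N → ℂ) (x v : RN N) :
    ‖dirDeriv k f x v‖ ≤ ‖v‖ ^ k * derivSum k f x := by
  induction k generalizing f with
  | zero => simp [dirDeriv, derivSum]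
  | succ k ih =>
    simp only [dirDeriv, derivSum, Finset.mul_sum]
    refine (norm_sum_le _ _).trans (Finset.sum_le_sum fun i _ => ?_)
    rw [norm_mul, pow_succ', mul_assoc]
    have : ‖(v i : ℂ)‖ ≤ ‖v‖ := by
      rw [Complex.norm_real]; exact PiLp.norm_apply_le v i
    exact mul_le_mul this (ih _) (norm_nonneg _) (norm_nonneg _)

lemma hasDerivAt_dirDeriv (k : ℕ) {f : RN N → ℂ} (hf : ContDiff ℝ (⊤ : ℕ∞) f) (x v : RN N)
    (s : ℝ) :
    HasDerivAt (fun s : ℝ => dirDeriv k f (x + s • v) v) (dirDeriv (k + 1) f (x + s • v) v) s := by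
  induction k generalizing f with
  | zero =>
    have h1 : HasDerivAt (fun s : ℝ => x + s • v) v s := by
      simpa using ((hasDerivAt_id s).smul_const v).const_add x
    have h2 : HasFDerivAt f (fderiv ℝ f (x + s • v)) (x + s • v) :=
      (hf.differentiable (by simp) _).hasFDerivAt
    have h3 := h2.comp_hasDerivAt s h1
    have hL : ∀ L : RN N →L[ℝ] ℂ, L v = ∑ i, (v i : ℂ) * L (EuclideanSpace.single i 1) := by
      intro L
      conv_lhs => rw [← (EuclideanSpace.basisFun (Fin N) ℝ).sum_repr v, map_sum]
      simp
    exact h3.congr_deriv (hL _)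
  | succ k ih =>
    exact HasDerivAt.fun_sum fun i _ => (ih (hf.pd i)).const_mul _

/-- The Taylor polynomial of `f` at `x` of degree less than `m`, at the displacement `v`. -/
def taylorSum (m : ℕ) (f : RN N → ℂ) (x v : RN N) : ℂ :=
  ∑ k ∈ Finset.range m, ((k.factorial : ℂ))⁻¹ * dirDeriv k f x v

lemma continuous_taylorSum (m : ℕ) {f : RN N → ℂ} (hf : ContDiff ℝ (⊤ : ℕ∞) f) :
    Continuous fun z : RN N × RN N => taylorSum m f z.1 z.2 :=
  continuous_finsetSum _ fun k _ => (continuous_dirDeriv k hf).const_mul _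

lemma hasDerivAt_taylorSum_aux (m : ℕ) {f : RN N → ℂ} (hf : ContDiff ℝ (⊤ : ℕ∞) f) (x v : RN N)
    (s : ℝ) :
    HasDerivAt (fun s : ℝ => taylorSum (m + 1) f (x + s • v) ((1 - s) • v))
      (((m.factorial : ℂ))⁻¹ * ((1 - s : ℝ) : ℂ) ^ m * dirDeriv (m + 1) f (x + s • v) v) s := by
  have hhom : ∀ (k : ℕ) (f : RN N → ℂ) (x v : RN N) (c : ℝ),
      dirDeriv k f x (c • v) = (c : ℂ) ^ k * dirDeriv k f x v := by
    intro k
    induction k with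
    | zero => intro f x v c; simp [dirDeriv]
    | succ k ih =>
      intro f x v c
      simp only [dirDeriv, Finset.mul_sum, ih]
      refine Finset.sum_congr rfl fun i _ => ?_
      simp; ring
  simp only [taylorSum, hhom]
  have hc : ∀ k : ℕ, HasDerivAt (fun s : ℝ => ((1 - s : ℝ) : ℂ) ^ k)
      (-(k * ((1 - s : ℝ) : ℂ) ^ (k - 1))) s := by
    intro k
    have := (((hasDerivAt_id s).const_sub 1).ofReal_comp).fun_pow k
    exact this.congr_deriv (by simp)
  induction m with
  | zero =>
    have := ((hc 0).mul (hasDerivAt_dirDeriv 0 hf x v s)).const_mul ((Nat.factorial 0 : ℂ)⁻¹)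
    simpa using this
  | succ m ih =>
    have h2 := ((hc (m + 1)).mul (hasDerivAt_dirDeriv (m + 1) hf x v s)).const_mul
      ((Nat.factorial (m + 1) : ℂ)⁻¹)
    have h3 := ih.add h2
    simp only [Finset.sum_range_succ _ (m + 1)]
    refine h3.congr_deriv ?_
    have : (Nat.factorial m : ℂ) ≠ 0 := by exact_mod_cast Nat.factorial_ne_zero m
    have h4 : ((m : ℂ) + 1) ≠ 0 := by exact_mod_cast Nat.succ_ne_zero m
    rw [Nat.factorial_succ]
    push_cast
    field_simp
    ring

/-- Taylor's formula with an integral bound for the remainder. -/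
lemma norm_sub_taylorSum_le {m : ℕ} (hm : 1 ≤ m) {f : RN N → ℂ} (hf : ContDiff ℝ (⊤ : ℕ∞) f)
    (x v : RN N) :
    ‖f (x + v) - taylorSum m f x v‖ ≤
      ‖v‖ ^ m * ∫ s in (0 : ℝ)..1, derivSum m f (x + s • v) := by
  obtain ⟨m, rfl⟩ : ∃ n, m = n + 1 := ⟨m - 1, by omega⟩
  have hcont : Continuous fun s : ℝ =>
      ((m.factorial : ℂ))⁻¹ * ((1 - s : ℝ) : ℂ) ^ m * dirDeriv (m + 1) f (x + s • v) v := by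
    have : Continuous fun s : ℝ => dirDeriv (m + 1) f (x + s • v) v :=
      (continuous_dirDeriv (m + 1) hf).comp
        (by fun_prop : Continuous fun s : ℝ => ((x + s • v, v) : RN N × RN N))
    fun_prop
  have hcD : Continuous fun s : ℝ => derivSum (m + 1) f (x + s • v) :=
    (continuous_derivSum _ hf).comp (by fun_prop)
  have hftc := intervalIntegral.integral_eq_sub_of_hasDerivAt
    (fun s _ => hasDerivAt_taylorSum_aux m hf x v s) (hcont.intervalIntegrable 0 1)
  have h1 : taylorSum (m + 1) f (x + (1 : ℝ) • v) ((1 - 1 : ℝ) • v) = f (x + v) := by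
    rw [taylorSum, Finset.sum_range_succ']
    simp [dirDeriv]
  rw [h1, zero_smul, add_zero, sub_zero, one_smul] at hftc
  rw [← hftc, ← intervalIntegral.integral_const_mul]
  refine intervalIntegral.norm_integral_le_of_norm_le zero_le_one
    (Filter.Eventually.of_forall fun s hs => ?_) ((hcD.const_mul _).intervalIntegrable 0 1)
  rw [norm_mul]
  have hle : ‖((m.factorial : ℂ))⁻¹ * ((1 - s : ℝ) : ℂ) ^ m‖ ≤ 1 := by
    rw [norm_mul, norm_inv, norm_pow, Complex.norm_real, Complex.norm_natCast]
    refine mul_le_one₀ (inv_le_one_of_one_le₀ ?_) (by positivity) (pow_le_one₀ (norm_nonneg _) ?_)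
    · exact_mod_cast Nat.one_le_iff_ne_zero.2 (Nat.factorial_ne_zero m)
    · rw [Real.norm_eq_abs, abs_le]
      constructor <;> linarith [hs.1, hs.2]
  calc _ ≤ 1 * ‖dirDeriv (m + 1) f (x + s • v) v‖ :=
        mul_le_mul_of_nonneg_right hle (norm_nonneg _)
    _ ≤ _ := by rw [one_mul]; exact norm_dirDeriv_le _ _ _ _

lemma isPolyDegLE_of_mvPolynomial {d : ℕ} {P : RN N → ℂ} (q : MvPolynomial (Fin N) ℂ)
    (hq : q.totalDegree ≤ d) (hP : ∀ x : RN N, P x = MvPolynomial.eval (fun i => (x i : ℂ)) q) :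
    IsPolyDegLE N d P := by
  refine ⟨fun α => q.coeff (Finsupp.equivFunOnFinite.symm α), fun x => ?_⟩
  rw [hP, MvPolynomial.eval_eq']
  refine Finset.sum_bij_ne_zero (fun a _ _ => ⇑a) ?_ ?_ ?_ ?_
  · intro a ha _
    rw [mem_idxLe, mOrder]
    refine le_trans (le_of_eq ?_) ((MvPolynomial.le_totalDegree ha).trans hq)
    rw [Finsupp.sum_fintype _ _ (fun _ => rfl)]
  · intro a _ _ b _ _ h
    exact DFunLike.coe_injective h
  · intro b _ hb
    refine ⟨Finsupp.equivFunOnFinite.symm b, ?_, ?_, rfl⟩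
    · rw [MvPolynomial.mem_support_iff]
      exact left_ne_zero_of_mul hb
    · exact hb
  · intro a _ _
    simp

lemma exists_mvPolynomial_dirDeriv (k : ℕ) (f : RN N → ℂ) (x : RN N) :
    ∃ q : MvPolynomial (Fin N) ℂ, q.totalDegree ≤ k ∧
      ∀ y : RN N, dirDeriv k f x (y - x) = MvPolynomial.eval (fun i => (y i : ℂ)) q := by
  induction k generalizing f with
  | zero => exact ⟨MvPolynomial.C (f x), by simp, fun y => by simp [dirDeriv]⟩
  | succ k ih =>
    choose q hq hq' using fun i : Fin N => ih (pd i f)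
    refine ⟨∑ i, (MvPolynomial.X i - MvPolynomial.C (x i : ℂ)) * q i, ?_, fun y => ?_⟩
    · refine MvPolynomial.totalDegree_finsetSum_le fun i _ =>
        (MvPolynomial.totalDegree_mul _ _).trans ?_
      rw [add_comm k 1]
      refine add_le_add ((MvPolynomial.totalDegree_sub _ _).trans ?_) (hq i)
      simp
    · simp [dirDeriv, hq', map_sum]

lemma isPolyDegLE_taylorSum (m : ℕ) (f : RN N → ℂ) (x : RN N) :
    IsPolyDegLE N (m - 1) fun y => taylorSum m f x (y - x) := by
  choose q hq hq' using fun k : ℕ => exists_mvPolynomial_dirDeriv k f x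
  refine isPolyDegLE_of_mvPolynomial
    (∑ k ∈ Finset.range m, MvPolynomial.C ((k.factorial : ℂ))⁻¹ * q k) ?_ fun y => ?_
  · refine MvPolynomial.totalDegree_finsetSum_le fun k hk =>
      (MvPolynomial.totalDegree_mul _ _).trans ?_
    have := hq k
    have := Finset.mem_range.1 hk
    simp only [MvPolynomial.totalDegree_C]
    omega
  · simp [taylorSum, hq', map_sum]

lemma lintegral_ball_homothety_div_le {u : RN N → ℝ≥0∞} (hu : Measurable u) (x : RN N) {s t : ℝ}
    (hs : s ∈ Ioc (0 : ℝ) 1) (ht : t ∈ Ioo (0 : ℝ) 1) :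
    (∫⁻ y in ball x t, u (x + s • (y - x))) / volume (ball x t) ≤ localMaximal u x := by
  have hs0 := hs.1
  have ht0 := ht.1
  have hst : s * t ∈ Ioo (0 : ℝ) 1 :=
    ⟨mul_pos hs0 ht0, (mul_le_of_le_one_left ht0.le hs.2).trans_lt ht.2⟩
  set g : RN N → ℝ≥0∞ := (ball x (s * t)).indicator u with hg
  have hgm : Measurable g := hu.indicator measurableSet_ball
  have h1 : ∫⁻ y in ball x t, u (x + s • (y - x)) = ∫⁻ y, g (x + s • (y - x)) := by
    rw [← lintegral_indicator measurableSet_ball]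
    refine lintegral_congr fun y => ?_
    have hiff : x + s • (y - x) ∈ ball x (s * t) ↔ y ∈ ball x t := by
      rw [mem_ball_iff_norm, mem_ball_iff_norm, add_sub_cancel_left, norm_smul,
        Real.norm_of_nonneg hs0.le, mul_lt_mul_iff_right₀ hs0]
    by_cases hy : y ∈ ball x t
    · rw [indicator_of_mem hy, hg, indicator_of_mem (hiff.2 hy)]
    · rw [indicator_of_notMem hy, hg, indicator_of_notMem (fun h => hy (hiff.1 h))]
  have h2 : ∫⁻ y, g (x + s • (y - x)) =
      ENNReal.ofReal ((s ^ N)⁻¹) * ∫⁻ y in ball x (s * t), u y := by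
    rw [lintegral_sub_right_eq_self (fun y => g (x + s • y)) x,
      ← lintegral_map (f := fun z => g (x + z)) (g := fun y => s • y) (by fun_prop) (by fun_prop),
      Measure.map_addHaar_smul _ hs0.ne', lintegral_smul_measure,
      lintegral_add_left_eq_self g x, hg, lintegral_indicator measurableSet_ball,
      finrank_euclideanSpace, Fintype.card_fin, abs_of_pos (by positivity), smul_eq_mul]
  have h3 : volume (ball x (s * t)) = ENNReal.ofReal (s ^ N) * volume (ball x t) := by
    rw [volume_ball_RN x hst.1, volume_ball_RN x ht0, mul_pow,
      ENNReal.ofReal_mul (by positivity), mul_assoc]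
  refine le_trans (le_of_eq ?_) (le_iSup₂ (f := fun t (_ : t ∈ Ioo (0 : ℝ) 1) =>
    (∫⁻ y in ball x t, u y) / volume (ball x t)) (s * t) hst)
  have hsN : ENNReal.ofReal (s ^ N) ≠ 0 := by
    rw [Ne, ENNReal.ofReal_eq_zero, not_le]; positivity
  change _ = _ / _
  rw [h1, h2, h3, ENNReal.div_eq_inv_mul, ENNReal.div_eq_inv_mul,
    ENNReal.mul_inv (Or.inl hsN) (Or.inl ENNReal.ofReal_ne_top),
    ENNReal.ofReal_inv_of_pos (by positivity)]
  ring

lemma integral_dil {φ : RN N → ℝ} (hφ : GoodPhi φ) {t : ℝ} (ht : 0 < t) :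
    ∫ z, dil φ t z = 1 := by
  simp only [dil, div_eq_mul_inv]
  rw [integral_mul_const, Measure.integral_comp_inv_smul_of_nonneg _ _ ht.le, hφ.int_one,
    finrank_euclideanSpace, Fintype.card_fin, smul_eq_mul, mul_one]
  exact mul_inv_cancel₀ (by positivity)

lemma support_dil_subset {φ : RN N → ℝ} (hφ : GoodPhi φ) {t : ℝ} (ht : 0 < t) :
    Function.support (dil φ t) ⊆ closedBall 0 t := by
  intro z hz
  have h1 : φ (t⁻¹ • z) ≠ 0 := fun h => hz (by simp [dil, h])
  have h2 := hφ.supp (subset_tsupport _ h1)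
  rw [mem_closedBall_zero_iff, norm_smul, norm_inv, Real.norm_of_nonneg ht.le,
    inv_mul_le_iff₀ ht, mul_one] at h2
  exact mem_closedBall_zero_iff.2 h2

lemma tendsto_convAt {φ : RN N → ℝ} (hφ : GoodPhi φ) {u : RN N → ℂ} (hu : Continuous u)
    (x : RN N) : Tendsto (fun t => convAt φ t u x) (𝓝[>] 0) (𝓝 (u x)) := by
  have hsmall : Tendsto (fun t => Function.support (dil φ t)) (𝓝[>] (0 : ℝ))
      (𝓝 (0 : RN N)).smallSets := by
    rw [tendsto_smallSets_iff]
    intro U hU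
    obtain ⟨ε, hε, hεU⟩ := Metric.nhds_basis_closedBall.mem_iff.1 hU
    filter_upwards [Ioo_mem_nhdsGT hε] with t ht
    exact (support_dil_subset hφ ht.1).trans ((closedBall_subset_closedBall ht.2.le).trans hεU)
  have h := convolution_tendsto_right (μ := (volume : Measure (RN N)))
    (φ := fun t : ℝ => dil φ t) (g := fun _ : ℝ => u) (k := fun _ => x) (x₀ := x) (z₀ := u x)
    (by
      filter_upwards [self_mem_nhdsWithin] with t ht z
      exact div_nonneg (hφ.nonneg _) (pow_nonneg (le_of_lt ht) _))
    (by filter_upwards [self_mem_nhdsWithin] with t ht using integral_dil hφ ht)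
    hsmall
    (Filter.Eventually.of_forall fun _ => hu.aestronglyMeasurable)
    ((hu.tendsto x).comp tendsto_snd) tendsto_const_nhds
  refine h.congr fun t => ?_
  rw [convolution_eq_swap]
  rfl

lemma ofReal_norm_le_smallMax {φ : RN N → ℝ} (hφ : GoodPhi φ) {u : RN N → ℂ}
    (hu : Continuous u) (x : RN N) : ENNReal.ofReal ‖u x‖ ≤ smallMax φ u x := by
  refine le_of_tendsto (ENNReal.tendsto_ofReal (tendsto_convAt hφ hu x).norm) ?_
  filter_upwards [Ioo_mem_nhdsGT (zero_lt_one' ℝ)] with t ht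
  exact le_iSup₂ (f := fun t (_ : t ∈ Ioo (0 : ℝ) 1) => ENNReal.ofReal ‖convAt φ t u x‖) t ht

lemma lintegral_norm_rpow_le_hNorm {φ : RN N → ℝ} (hφ : GoodPhi φ) {u : RN N → ℂ}
    (hu : Continuous u) {p : ℝ} (hp : 0 < p) :
    ∫⁻ x, ENNReal.ofReal ‖u x‖ ^ p ≤ hNorm φ p u ^ p := by
  rw [hNorm, ← ENNReal.rpow_mul, one_div_mul_cancel hp.ne', ENNReal.rpow_one]
  exact lintegral_mono fun x => ENNReal.rpow_le_rpow (ofReal_norm_le_smallMax hφ hu x) hp.le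

/-- Averaging over a ball the means of `w` along the radii is controlled by the maximal function. -/
lemma ofReal_average_le_localMaximal {w h : RN N → ℝ} (hw : Continuous w) (hw0 : ∀ x, 0 ≤ w x)
    (hh0 : ∀ y, 0 ≤ h y) (hhc : Continuous h) (x : RN N) {t : ℝ} (ht : t ∈ Ioo (0 : ℝ) 1)
    (hle : ∀ y ∈ ball x t, h y ≤ ∫ s in (0 : ℝ)..1, w (x + s • (y - x))) :
    ENNReal.ofReal (⨍ y in ball x t, h y) ≤ localMaximal (fun y => ENNReal.ofReal (w y)) x := by
  have hwm : Measurable fun y => ENNReal.ofReal (w y) := hw.measurable.ennreal_ofReal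
  have hhi : IntegrableOn h (ball x t) :=
    (hhc.continuousOn.integrableOn_compact (isCompact_closedBall x t)).mono_set
      ball_subset_closedBall
  have hV0 : volume (ball x t) ≠ 0 := (measure_ball_pos _ _ ht.1).ne'
  have hV : volume (ball x t) ≠ ∞ := measure_ball_lt_top.ne
  have h1 : ENNReal.ofReal (⨍ y in ball x t, h y) =
      (∫⁻ y in ball x t, ENNReal.ofReal (h y)) / volume (ball x t) := by
    rw [setAverage_eq, smul_eq_mul, ENNReal.ofReal_mul (by positivity),
      ofReal_integral_eq_lintegral_ofReal hhi (Filter.Eventually.of_forall hh0),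
      Measure.real, ENNReal.ofReal_inv_of_pos (ENNReal.toReal_pos hV0 hV),
      ENNReal.ofReal_toReal hV, ENNReal.div_eq_inv_mul]
  have h2 : ∀ y ∈ ball x t, ENNReal.ofReal (h y) ≤
      ∫⁻ s in Ioc (0 : ℝ) 1, ENNReal.ofReal (w (x + s • (y - x))) := by
    intro y hy
    have hc : Continuous fun s : ℝ => w (x + s • (y - x)) := hw.comp (by fun_prop)
    rw [← ofReal_integral_eq_lintegral_ofReal hc.integrableOn_Ioc
      (Filter.Eventually.of_forall fun _ => hw0 _),
      ← intervalIntegral.integral_of_le zero_le_one]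
    exact ENNReal.ofReal_le_ofReal (hle y hy)
  rw [h1]
  refine ENNReal.div_le_of_le_mul ?_
  calc ∫⁻ y in ball x t, ENNReal.ofReal (h y)
      ≤ ∫⁻ y in ball x t, ∫⁻ s in Ioc (0 : ℝ) 1, ENNReal.ofReal (w (x + s • (y - x))) :=
        setLIntegral_mono' measurableSet_ball h2
    _ = ∫⁻ s in Ioc (0 : ℝ) 1, ∫⁻ y in ball x t, ENNReal.ofReal (w (x + s • (y - x))) := by
        refine lintegral_lintegral_swap (Measurable.aemeasurable ?_)
        exact hwm.comp (by
          have : Continuous fun z : RN N × ℝ => x + z.2 • (z.1 - x) := by fun_prop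
          exact this.measurable)
    _ ≤ ∫⁻ _ in Ioc (0 : ℝ) 1, localMaximal (fun y => ENNReal.ofReal (w y)) x *
          volume (ball x t) := by
        refine setLIntegral_mono' measurableSet_Ioc fun s hs => ?_
        exact (ENNReal.div_le_iff hV0 hV).1 (lintegral_ball_homothety_div_le hwm x hs ht)
    _ = _ := by simp

lemma rpow_intervalIntegral_le {α : ℝ} (hα : 1 ≤ α) {g : ℝ → ℝ} (hg : Continuous g)
    (hg0 : ∀ s, 0 ≤ g s) :
    (∫ s in (0 : ℝ)..1, g s) ^ α ≤ ∫ s in (0 : ℝ)..1, g s ^ α := by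
  rw [intervalIntegral.integral_of_le zero_le_one, intervalIntegral.integral_of_le zero_le_one]
  have : IsProbabilityMeasure (volume.restrict (Ioc (0 : ℝ) 1)) := ⟨by simp⟩
  exact (convexOn_rpow hα).map_integral_le
    (continuousOn_id.rpow_const fun _ _ => Or.inr (by linarith)) isClosed_Ici
    (Filter.Eventually.of_forall fun s => hg0 s) hg.integrableOn_Ioc
    (hg.rpow_const fun _ => Or.inr (by linarith)).integrableOn_Ioc

lemma ofReal_average_taylor_le {m : ℕ} (hm : 1 ≤ m) {α : ℝ} (hα : 1 ≤ α) {f : RN N → ℂ}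
    (hf : ContDiff ℝ (⊤ : ℕ∞) f) (x : RN N) {t : ℝ} (ht : t ∈ Ioo (0 : ℝ) 1) :
    ENNReal.ofReal (⨍ y in ball x t, ((t ^ m)⁻¹ * ‖f y - taylorSum m f x (y - x)‖) ^ α) ≤
      localMaximal (fun y => ENNReal.ofReal (derivSum m f y ^ α)) x := by
  have ht0 := ht.1
  have hα0 : 0 ≤ α := by linarith
  have hG := continuous_derivSum m hf
  have hT : Continuous fun y => taylorSum m f x (y - x) :=
    (continuous_taylorSum m hf).comp (by fun_prop : Continuous fun y : RN N => (x, y - x))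
  refine ofReal_average_le_localMaximal
    (h := fun y => ((t ^ m)⁻¹ * ‖f y - taylorSum m f x (y - x)‖) ^ α) (hG.rpow_const fun _ => Or.inr hα0)
    (fun y => Real.rpow_nonneg (derivSum_nonneg _ _ _) _)
    (fun y => Real.rpow_nonneg (by positivity) _)
    ((continuous_const.mul (hf.continuous.sub hT).norm).rpow_const fun _ => Or.inr hα0)
    x ht fun y hy => ?_
  have hGl : Continuous fun s : ℝ => derivSum m f (x + s • (y - x)) := hG.comp (by fun_prop)
  refine le_trans ?_ (rpow_intervalIntegral_le hα hGl fun s => derivSum_nonneg _ _ _)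
  refine Real.rpow_le_rpow (by positivity) ?_ hα0
  rw [inv_mul_le_iff₀ (by positivity)]
  have h := norm_sub_taylorSum_le hm hf x (y - x)
  rw [add_sub_cancel] at h
  refine h.trans (mul_le_mul_of_nonneg_right ?_
    (intervalIntegral.integral_nonneg zero_le_one fun _ _ => derivSum_nonneg _ _ _))
  exact pow_le_pow_left₀ (norm_nonneg _) (mem_ball_iff_norm.1 hy).le _

lemma lintegral_derivSum_rpow_le {φ : RN N → ℝ} (hφ : GoodPhi φ) (m : ℕ) {p : ℝ} (hp : 1 ≤ p)
    {f : RN N → ℂ} (hf : ContDiff ℝ (⊤ : ℕ∞) f) :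
    ∫⁻ x, ENNReal.ofReal (derivSum m f x) ^ p ≤
      (ENNReal.ofReal ((N : ℝ) ^ m) ^ p * ((idxLe N m).card : ℝ≥0∞) ^ p) *
        (∑ β ∈ idxLe N m, hNorm φ p (md β f)) ^ p := by
  have hp0 : 0 < p := by linarith
  set c := (idxLe N m).card with hc
  have hpt : ∀ x, ENNReal.ofReal (derivSum m f x) ^ p ≤
      (ENNReal.ofReal ((N : ℝ) ^ m) ^ p * (c : ℝ≥0∞) ^ (p - 1)) *
        ∑ β ∈ idxLe N m, ENNReal.ofReal ‖md β f x‖ ^ p := by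
    intro x
    have h := derivSum_md_le hf (m := m) m 0 (by simp [mOrder]) x
    rw [md_zero] at h
    have h' := ENNReal.ofReal_le_ofReal h
    rw [ENNReal.ofReal_mul (by positivity),
      ENNReal.ofReal_sum_of_nonneg (fun _ _ => norm_nonneg _)] at h'
    refine (ENNReal.rpow_le_rpow h' hp0.le).trans ?_
    rw [ENNReal.mul_rpow_of_nonneg _ _ hp0.le, mul_assoc]
    gcongr
    exact ENNReal.rpow_sum_le_const_mul_sum_rpow _ _ hp
  have hmeas : ∀ β ∈ idxLe N m, Measurable fun x => ENNReal.ofReal ‖md β f x‖ ^ p := fun β _ =>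
    (hf.md β).continuous.norm.measurable.ennreal_ofReal.pow_const p
  calc ∫⁻ x, ENNReal.ofReal (derivSum m f x) ^ p
      ≤ ∫⁻ x, (ENNReal.ofReal ((N : ℝ) ^ m) ^ p * (c : ℝ≥0∞) ^ (p - 1)) *
          ∑ β ∈ idxLe N m, ENNReal.ofReal ‖md β f x‖ ^ p := lintegral_mono hpt
    _ = (ENNReal.ofReal ((N : ℝ) ^ m) ^ p * (c : ℝ≥0∞) ^ (p - 1)) *
          ∑ β ∈ idxLe N m, ∫⁻ x, ENNReal.ofReal ‖md β f x‖ ^ p := by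
        rw [lintegral_const_mul _ (Finset.measurable_fun_sum _ hmeas), lintegral_finsetSum _ hmeas]
    _ ≤ (ENNReal.ofReal ((N : ℝ) ^ m) ^ p * (c : ℝ≥0∞) ^ (p - 1)) *
          ∑ _β ∈ idxLe N m, (∑ β ∈ idxLe N m, hNorm φ p (md β f)) ^ p := by
        gcongr with β hβ
        refine (lintegral_norm_rpow_le_hNorm hφ (hf.md β).continuous hp0).trans ?_
        gcongr
        exact Finset.single_le_sum (f := fun β => hNorm φ p (md β f)) (fun _ _ => zero_le) hβ
    _ = _ := by
        have hc0 : (c : ℝ≥0∞) ≠ 0 := by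
          rw [Ne, Nat.cast_eq_zero, hc, Finset.card_eq_zero]
          exact Finset.ne_empty_of_mem (a := 0) (mem_idxLe.2 (by simp [mOrder]))
        have hcp : (c : ℝ≥0∞) ^ p = (c : ℝ≥0∞) ^ (p - 1) * c := by
          rw [ENNReal.rpow_sub p 1 hc0 (ENNReal.natCast_ne_top c), ENNReal.rpow_one,
            ENNReal.div_mul_cancel hc0 (ENNReal.natCast_ne_top c)]
        rw [Finset.sum_const, nsmul_eq_mul, ← hc, hcp]
        ring

/-- Lemma 6.1 (main Poincaré-type inequality on Hardy–Sobolev spaces), case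
`1 < p < ∞`, `m < N`, `α ∈ [1, p)`. -/
theorem statement13 {N m : ℕ} (hN : 2 ≤ N) (hm : 1 ≤ m) (hmN : m < N) (p α : ℝ)
    (hp₁ : 1 < p) (hα₁ : 1 ≤ α) (hα₂ : α < p)
    (φ₀ : RN N → ℝ) (hφ₀ : GoodPhi φ₀) :
    ∃ C : ℝ, 0 < C ∧
      ∀ f : RN N → ℂ, ContDiff ℝ (⊤ : ℕ∞) f → HasCompactSupport f →
        ∃ P : RN N → ℝ → RN N → ℂ,
          (∀ x t, IsPolyDegLE N (m - 1) (P x t)) ∧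
          ContinuousOn (fun z : (RN N × ℝ) × RN N => P z.1.1 z.1.2 z.2)
            ((univ ×ˢ Ioo (0 : ℝ) 1) ×ˢ univ) ∧
          ∫⁻ x, (⨆ t ∈ Ioo (0 : ℝ) 1,
              ENNReal.ofReal (⨍ y in ball x t, ((t ^ m)⁻¹ * ‖f y - P x t y‖) ^ α)) ^ (p / α)
            ≤ ENNReal.ofReal C * (∑ β ∈ idxLe N m, hNorm φ₀ p (md β f)) ^ p := by
  set q := p / α with hq
  have hα0 : 0 < α := by linarith
  have hp0 : 0 < p := by linarith
  have hq1 : 1 < q := (one_lt_div hα0).2 hα₂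
  set A : ℝ≥0∞ := ENNReal.ofReal (2 ^ q * q * 5 ^ N / (q - 1)) *
    (ENNReal.ofReal ((N : ℝ) ^ m) ^ p * ((idxLe N m).card : ℝ≥0∞) ^ p) with hA
  have hAtop : A ≠ ∞ := ENNReal.mul_ne_top ENNReal.ofReal_ne_top
    (ENNReal.mul_ne_top (ENNReal.rpow_ne_top_of_nonneg hp0.le ENNReal.ofReal_ne_top)
      (ENNReal.rpow_ne_top_of_nonneg hp0.le (ENNReal.natCast_ne_top _)))
  refine ⟨A.toReal + 1, by positivity, fun f hf hfc =>
    ⟨fun x _ y => taylorSum m f x (y - x), fun x _ => isPolyDegLE_taylorSum m f x, ?_, ?_⟩⟩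
  · exact ((continuous_taylorSum m hf).comp
      (by fun_prop : Continuous fun z : (RN N × ℝ) × RN N => (z.1.1, z.2 - z.1.1))).continuousOn
  obtain ⟨K, hK⟩ := exists_derivSum_le m hf hfc
  have hG0 := derivSum_nonneg m f
  calc _ ≤ ∫⁻ x, localMaximal (fun y => ENNReal.ofReal (derivSum m f y ^ α)) x ^ q := by
        refine lintegral_mono fun x => ENNReal.rpow_le_rpow ?_ (by linarith)
        exact iSup₂_le fun t ht => ofReal_average_taylor_le hm hα₁ hf x ht
    _ ≤ ENNReal.ofReal (2 ^ q * q * 5 ^ N / (q - 1)) *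
          ∫⁻ x, ENNReal.ofReal ((derivSum m f x ^ α) ^ q) :=
        lintegral_localMaximal_rpow_le hq1
          ((continuous_derivSum m hf).rpow_const fun _ => Or.inr hα0.le).measurable
          (fun x => Real.rpow_nonneg (hG0 x) _)
          (fun x => Real.rpow_le_rpow (hG0 x) (hK x) hα0.le)
    _ = ENNReal.ofReal (2 ^ q * q * 5 ^ N / (q - 1)) *
          ∫⁻ x, ENNReal.ofReal (derivSum m f x) ^ p := by
        congr 1
        refine lintegral_congr fun x => ?_
        rw [← Real.rpow_mul (hG0 x), hq, mul_div_cancel₀ _ hα0.ne',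
          ENNReal.ofReal_rpow_of_nonneg (hG0 x) hp0.le]
    _ ≤ A * (∑ β ∈ idxLe N m, hNorm φ₀ p (md β f)) ^ p := by
        exact (mul_le_mul_right (lintegral_derivSum_rpow_le hφ₀ m hp₁.le hf) _).trans_eq
          (mul_assoc _ _ _).symm
    _ ≤ _ := by
        gcongr
        exact (ENNReal.ofReal_toReal hAtop).symm.le.trans
          (ENNReal.ofReal_le_ofReal (by linarith))
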